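/- Let d ≥ 3, v : ℝ^d → ℝ bounded measurable with bounded support, Y_x = ∫₀^∞ v(W_x(s)) ds. If α ∈ ℝ is such that E[e^{α Y_x}] < ∞ for all x, then the function x ↦ E[e^{α Y_x}] is continuous on ℝ^d. -/

import Mathlib

open MeasureTheory Real Filter Topology ProbabilityTheory

noncomputable section

/-- Euclidean space `ℝ^d`. -/
abbrev Euc (d : ℕ) := EuclideanSpace ℝ (Fin d)

/-- The Brownian transition density `q(s; w) = (2πs)^{-d/2} exp(-|w|²/(2s))`. -/
def heatKernel (d : ℕ) (s : ℝ) (w : Euc d) : ℝ :=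
  (2 * π * s) ^ (-(d : ℝ) / 2) * Real.exp (-‖w‖ ^ 2 / (2 * s))

/-- Joint density of a Brownian motion started at `x`, at times `s 0 < s 1 < ⋯`. -/
def jointDensity (d : ℕ) {k : ℕ} (x : Euc d) (s : Fin k → ℝ) (z : Fin k → Euc d) : ℝ :=
  ∏ j : Fin k,
    heatKernel d (s j - if (j : ℕ) = 0 then 0 else s ⟨(j : ℕ) - 1, lt_of_le_of_lt (Nat.sub_le _ _) j.isLt⟩)
      (z j - if (j : ℕ) = 0 then x else z ⟨(j : ℕ) - 1, lt_of_le_of_lt (Nat.sub_le _ _) j.isLt⟩)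

/-- Joint density of the Brownian bridge from `a` to `b` in time `t`, at interior times `s`. -/
def bridgeDensity (d : ℕ) {k : ℕ} (t : ℝ) (a b : Euc d) (s : Fin k → ℝ) (z : Fin k → Euc d) : ℝ :=
  jointDensity d a (Fin.snoc s t) (Fin.snoc z b) / heatKernel d t (b - a)

/-- The open ordered simplex `0 < s₁ < ⋯ < s_k < t`. -/
def simplex (k : ℕ) (t : ℝ) : Set (Fin k → ℝ) :=
  {s | StrictMono s ∧ ∀ i, 0 < s i ∧ s i < t}

/-- `W` is a standard `d`-dimensional Brownian motion started at `x`, characterized by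
continuous paths and finite-dimensional densities given by products of heat kernels. -/
def IsBrownianMotion {Ω : Type*} [MeasureSpace Ω] {d : ℕ} (x : Euc d)
    (W : ℝ → Ω → Euc d) : Prop :=
  (∀ ω, W 0 ω = x) ∧ (∀ ω, Continuous fun s => W s ω) ∧
  ∀ (k : ℕ) (s : Fin (k + 1) → ℝ), StrictMono s → (∀ i, 0 < s i) →
    Measure.map (fun ω (i : Fin (k + 1)) => W (s i) ω) (ℙ : Measure Ω) =
      (volume : Measure (Fin (k + 1) → Euc d)).withDensity
        (fun z => ENNReal.ofReal (jointDensity d x s z))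

/-- `X` is a `d`-dimensional Brownian bridge from `a` to `b` in time `t`. -/
def IsBrownianBridge {Ω : Type*} [MeasureSpace Ω] {d : ℕ} (t : ℝ) (a b : Euc d)
    (X : ℝ → Ω → Euc d) : Prop :=
  (∀ ω, X 0 ω = a) ∧ (∀ ω, X t ω = b) ∧
  (∀ ω, ContinuousOn (fun s => X s ω) (Set.Icc 0 t)) ∧
  ∀ (k : ℕ) (s : Fin (k + 1) → ℝ), StrictMono s → (∀ i, 0 < s i ∧ s i < t) →
    Measure.map (fun ω (i : Fin (k + 1)) => X (s i) ω) (ℙ : Measure Ω) =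
      (volume : Measure (Fin (k + 1) → Euc d)).withDensity
        (fun z => ENNReal.ofReal (bridgeDensity d t a b s z))

/-- The path integral `∫₀^t v(X_s) ds`. -/
def pathInt {Ω : Type*} {d : ℕ} (v : Euc d → ℝ) (X : ℝ → Ω → Euc d) (t : ℝ) (ω : Ω) : ℝ :=
  ∫ s in Set.Ioc (0 : ℝ) t, v (X s ω)

/-- The total path integral `∫₀^∞ v(X_s) ds`. -/
def pathIntInf {Ω : Type*} {d : ℕ} (v : Euc d → ℝ) (X : ℝ → Ω → Euc d) (ω : Ω) : ℝ :=
  ∫ s in Set.Ioi (0 : ℝ), v (X s ω)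

/-- The density ratio `Q_{j} = q(t; y - x)/q(Δ_j s; Δ_j z)` with the conventions
`s₀ = 0`, `s_{k+1} = t`, `z₀ = x`, `z_{k+1} = y`. -/
def Qratio (d : ℕ) {k : ℕ} (t : ℝ) (x y : Euc d) (s : Fin k → ℝ) (z : Fin k → Euc d)
    (j : Fin (k + 1)) : ℝ :=
  heatKernel d t (y - x) /
    heatKernel d
      ((Fin.cons 0 (Fin.snoc s t) : Fin (k + 2) → ℝ) j.succ -
        (Fin.cons 0 (Fin.snoc s t) : Fin (k + 2) → ℝ) j.castSucc)
      ((Fin.cons x (Fin.snoc z y) : Fin (k + 2) → Euc d) j.succ -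
        (Fin.cons x (Fin.snoc z y) : Fin (k + 2) → Euc d) j.castSucc)

lemma heatKernel_pos (d : ℕ) {s : ℝ} (hs : 0 < s) (w : Euc d) : 0 < heatKernel d s w := by
  unfold heatKernel
  positivity

@[fun_prop]
lemma continuous_heatKernel (d : ℕ) (s : ℝ) : Continuous (heatKernel d s) := by
  unfold heatKernel
  fun_prop

@[fun_prop]
lemma measurable_heatKernel (d : ℕ) (s : ℝ) : Measurable (heatKernel d s) :=
  (continuous_heatKernel d s).measurable

lemma heatKernel_sub_le (d : ℕ) {s : ℝ} (hs : 0 < s) {x y : Euc d} (hxy : ‖y - x‖ ≤ 1)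
    (z : Euc d) :
    heatKernel d s (z - y) ≤
      (2 * π * s) ^ (-(d : ℝ) / 2) / (2 * π * (2 * s)) ^ (-(d : ℝ) / 2) *
        Real.exp (1 / (2 * s)) * heatKernel d (2 * s) (z - x) := by
  have hpos : 0 < (2 * π * (2 * s)) ^ (-(d : ℝ) / 2) := by positivity
  have hnorm : ‖z - x‖ ≤ ‖z - y‖ + 1 := by
    calc ‖z - x‖ = ‖(z - y) + (y - x)‖ := by rw [sub_add_sub_cancel]
      _ ≤ ‖z - y‖ + ‖y - x‖ := norm_add_le _ _
      _ ≤ _ := by gcongr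
  have hexp : -‖z - y‖ ^ 2 / (2 * s) ≤ 1 / (2 * s) + -‖z - x‖ ^ 2 / (2 * (2 * s)) := by
    have : 1 / (2 * s) + -‖z - x‖ ^ 2 / (2 * (2 * s)) = (1 - ‖z - x‖ ^ 2 / 2) / (2 * s) := by
      field_simp
      ring
    rw [this]
    gcongr
    nlinarith [norm_nonneg (z - x), norm_nonneg (z - y), sq_nonneg (‖z - y‖ - 1)]
  calc heatKernel d s (z - y)
      ≤ (2 * π * s) ^ (-(d : ℝ) / 2) *
          Real.exp (1 / (2 * s) + -‖z - x‖ ^ 2 / (2 * (2 * s))) := by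
        unfold heatKernel
        gcongr
    _ = _ := by
        unfold heatKernel
        rw [Real.exp_add]
        field_simp

lemma jointDensity_pos (d : ℕ) {k : ℕ} (x : Euc d) {s : Fin k → ℝ} (hs : StrictMono s)
    (hs0 : ∀ i, 0 < s i) (z : Fin k → Euc d) : 0 < jointDensity d x s z := by
  refine Finset.prod_pos fun j _ => heatKernel_pos d ?_ _
  split_ifs with hj
  · simpa using hs0 j
  · exact sub_pos.2 (hs (Fin.lt_def.2 (Nat.sub_lt (Nat.pos_of_ne_zero hj) one_pos)))

lemma measurable_jointDensity (d : ℕ) {k : ℕ} (s : Fin k → ℝ) :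
    Measurable fun p : Euc d × (Fin k → Euc d) => jointDensity d p.1 s p.2 := by
  unfold jointDensity
  refine Finset.measurable_prod _ fun j _ => (measurable_heatKernel d _).comp ?_
  split_ifs <;> fun_prop

/-- The Markov property at the level of densities. -/
lemma jointDensity_cons (d : ℕ) {k : ℕ} (y z₀ : Euc d) (s : ℝ) (t : Fin k → ℝ)
    (z : Fin k → Euc d) :
    jointDensity d y (Fin.cons s fun j => s + t j : Fin (k + 1) → ℝ)
      (Fin.cons z₀ z : Fin (k + 1) → Euc d) =
      heatKernel d s (z₀ - y) * jointDensity d z₀ t z := by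
  unfold jointDensity
  rw [Fin.prod_univ_succ]
  congr 1
  · simp
  · refine Finset.prod_congr rfl fun j _ => ?_
    simp only [Fin.cons_succ, Fin.val_succ, Nat.add_sub_cancel]
    obtain ⟨_ | j, hj⟩ := j
    · have h0 : (⟨0, Nat.succ_pos k⟩ : Fin (k + 1)) = 0 := rfl
      simp [h0]
    · change heatKernel d (s + t _ - (s + t ⟨j, _⟩)) (z _ - z ⟨j, _⟩) =
        heatKernel d (t _ - t ⟨j, _⟩) (z _ - z ⟨j, _⟩)
      rw [add_sub_add_left_eq_sub]

/-- The positive rationals, used as a countable dense set of times. -/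
abbrev PosRat := {q : ℚ // 0 < q}

/-- A positive rational approximation from above of a nonnegative real number. -/
def ratApprox (n : ℕ) (t : ℝ) : PosRat := ⟨(⌊t * (n + 1)⌋₊ + 1) / (n + 1), by positivity⟩

lemma measurable_ratApprox (n : ℕ) : Measurable (ratApprox n) := by
  refine Measurable.subtype_mk ?_
  have : Measurable fun t : ℝ => ⌊t * (n + 1)⌋₊ := Nat.measurable_floor.comp (by fun_prop)
  exact (measurable_from_nat (f := fun m : ℕ => ((m : ℚ) + 1) / (n + 1))).comp this

lemma tendsto_ratApprox {t : ℝ} (ht : 0 ≤ t) :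
    Tendsto (fun n => ((ratApprox n t : ℚ) : ℝ)) atTop (𝓝 t) := by
  have hup : Tendsto (fun n : ℕ => t + 1 / ((n : ℝ) + 1)) atTop (𝓝 t) := by
    simpa using tendsto_one_div_add_atTop_nhds_zero_nat.const_add t
  refine tendsto_of_tendsto_of_tendsto_of_le_of_le tendsto_const_nhds hup ?_ ?_ <;> intro n
  · have h := Nat.lt_floor_add_one (t * ((n : ℝ) + 1))
    simp only [ratApprox]
    push_cast
    rw [le_div_iff₀ (by positivity)]
    exact h.le
  · have h := Nat.floor_le (a := t * ((n : ℝ) + 1)) (by positivity)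
    simp only [ratApprox]
    push_cast
    rw [div_le_iff₀ (by positivity), add_mul, one_div_mul_cancel (by positivity)]
    linarith

/-- The path determined by its values at positive rational times. -/
def pathExt {d : ℕ} (f : PosRat → Euc d) (t : ℝ) : Euc d :=
  limUnder atTop fun n => f (ratApprox n t)

lemma measurable_pathExt (d : ℕ) :
    Measurable fun p : (PosRat → Euc d) × ℝ => pathExt p.1 p.2 := by
  refine (StronglyMeasurable.limUnder fun n => Measurable.stronglyMeasurable ?_).measurable
  have h : Measurable fun p : (PosRat → Euc d) × PosRat => p.1 p.2 :=
    measurable_from_prod_countable_left fun q => measurable_pi_apply q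
  exact h.comp (measurable_fst.prodMk ((measurable_ratApprox n).comp measurable_snd))

lemma pathExt_eq {d : ℕ} {w : ℝ → Euc d} (hw : Continuous w) {t : ℝ} (ht : 0 ≤ t) :
    pathExt (fun q : PosRat => w (q : ℚ)) t = w t :=
  ((hw.tendsto t).comp (tendsto_ratApprox ht)).limUnder_eq

/-- `exp (α ∫₀^∞ v)` as a functional of the values of the path at positive rational times. -/
def expFunctional {d : ℕ} (v : Euc d → ℝ) (α : ℝ) (f : PosRat → Euc d) : ENNReal :=
  ENNReal.ofReal (Real.exp (α * ∫ t in Set.Ioi (0 : ℝ), v (pathExt f t)))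

lemma measurable_expFunctional {d : ℕ} {v : Euc d → ℝ} (hv : Measurable v) (α : ℝ) :
    Measurable (expFunctional v α) := by
  have h := (hv.comp (measurable_pathExt d)).stronglyMeasurable.integral_prod_right'
    (ν := volume.restrict (Set.Ioi (0 : ℝ)))
  exact (Real.measurable_exp.comp (h.measurable.const_mul α)).ennreal_ofReal

lemma expFunctional_eq {d : ℕ} (v : Euc d → ℝ) (α : ℝ) {w : ℝ → Euc d} (hw : Continuous w) :
    expFunctional v α (fun q : PosRat => w (q : ℚ)) =
      ENNReal.ofReal (Real.exp (α * ∫ t in Set.Ioi (0 : ℝ), v (w t))) := by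
  unfold expFunctional
  rw [setIntegral_congr_fun measurableSet_Ioi fun t ht =>
    congrArg v (pathExt_eq hw (le_of_lt ht))]

/-- A cylinder over positive rational times is determined by a nonempty increasing tuple. -/
lemma exists_tuple_of_mem_measurableCylinders {E : Type*} [MeasurableSpace E]
    {S : Set (PosRat → E)} (hS : S ∈ measurableCylinders fun _ : PosRat => E) :
    ∃ (k : ℕ) (t : Fin (k + 1) → PosRat) (A : Set (Fin (k + 1) → E)), StrictMono t ∧
      MeasurableSet A ∧ S = (fun f j => f (t j)) ⁻¹' A := by
  obtain ⟨I, B, hB, rfl⟩ := (mem_measurableCylinders _).1 hS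
  set J : Finset PosRat := insert ⟨1, one_pos⟩ I with hJ
  have hcard : J.card = J.card - 1 + 1 :=
    (Nat.sub_add_cancel (Finset.card_pos.2 (Finset.insert_nonempty _ _))).symm
  let e := J.orderIsoOfFin hcard
  let g : (Fin (J.card - 1 + 1) → E) → I → E :=
    fun z i => z (e.symm ⟨i, Finset.mem_insert_of_mem i.2⟩)
  have hg : Measurable g := by fun_prop
  refine ⟨J.card - 1, fun j => e j, g ⁻¹' B, fun i j hij => e.strictMono hij, hg hB, ?_⟩
  ext f
  have : g (fun j => f (e j)) = I.restrict f := by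
    ext i
    simp [g]
  simp only [cylinder, Set.mem_preimage, this]

namespace IsBrownianMotion

variable {Ω : Type*} [MeasureSpace Ω] {d : ℕ} {x : Euc d} {X : ℝ → Ω → Euc d}

lemma aemeasurable_tuple (h : IsBrownianMotion x X) {k : ℕ} {s : Fin (k + 1) → ℝ}
    (hs : StrictMono s) (hs0 : ∀ i, 0 < s i) :
    AEMeasurable (fun ω i => X (s i) ω) (ℙ : Measure Ω) := by
  refine AEMeasurable.of_map_ne_zero ?_
  rw [h.2.2 k s hs hs0]
  intro h0
  have hm : Measurable fun z => ENNReal.ofReal (jointDensity d x s z) :=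
    ((measurable_jointDensity d s).comp measurable_prodMk_left).ennreal_ofReal
  rw [withDensity_eq_zero_iff hm.aemeasurable] at h0
  obtain ⟨z, hz⟩ := h0.exists
  exact (ENNReal.ofReal_pos.2 (jointDensity_pos d x hs hs0 z)).ne' hz

lemma aemeasurable_apply (h : IsBrownianMotion x X) {t : ℝ} (ht : 0 < t) :
    AEMeasurable (X t) (ℙ : Measure Ω) :=
  (measurable_pi_apply (0 : Fin 1)).comp_aemeasurable
    (h.aemeasurable_tuple (k := 0) (s := fun _ => t)
      (Subsingleton.strictMono (α := Fin 1) _) fun _ => ht)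

lemma aemeasurable_sample (h : IsBrownianMotion x X) {s : ℝ} (hs : 0 ≤ s) :
    AEMeasurable (fun ω (q : PosRat) => X (s + (q : ℚ)) ω) (ℙ : Measure Ω) :=
  aemeasurable_pi_iff.2 fun q =>
    h.aemeasurable_apply (add_pos_of_nonneg_of_pos hs (Rat.cast_pos.2 q.2))

end IsBrownianMotion

/-- The law of a process, started afresh at time `s`, sampled at positive rational times. -/
def sampledLaw {Ω : Type*} [MeasureSpace Ω] {d : ℕ} (X : ℝ → Ω → Euc d) (s : ℝ) :
    Measure (PosRat → Euc d) :=
  Measure.map (fun ω q => X (s + (q : ℚ)) ω) (ℙ : Measure Ω)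

namespace IsBrownianMotion

variable {Ω : Type*} [MeasureSpace Ω] {d : ℕ} {x : Euc d} {X : ℝ → Ω → Euc d}

lemma isProbabilityMeasure_sampledLaw [IsProbabilityMeasure (ℙ : Measure Ω)]
    (h : IsBrownianMotion x X) {s : ℝ} (hs : 0 ≤ s) :
    IsProbabilityMeasure (sampledLaw X s) :=
  Measure.isProbabilityMeasure_map (h.aemeasurable_sample hs)

lemma sampledLaw_zero_tuple (h : IsBrownianMotion x X) {k : ℕ} {t : Fin (k + 1) → PosRat}
    (ht : StrictMono t) {A : Set (Fin (k + 1) → Euc d)} (hA : MeasurableSet A) :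
    sampledLaw X 0 ((fun f j => f (t j)) ⁻¹' A) =
      ∫⁻ z in A, ENNReal.ofReal (jointDensity d x (fun j => ((t j : ℚ) : ℝ)) z) := by
  have hmono : StrictMono fun j => ((t j : ℚ) : ℝ) := fun i j hij => Rat.cast_lt.2 (ht hij)
  have hpos : ∀ j, 0 < ((t j : ℚ) : ℝ) := fun j => Rat.cast_pos.2 (t j).2
  rw [← withDensity_apply _ hA, ← h.2.2 k _ hmono hpos,
    Measure.map_apply_of_aemeasurable (h.aemeasurable_tuple hmono hpos) hA, sampledLaw,
    Measure.map_apply_of_aemeasurable (h.aemeasurable_sample le_rfl)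
      (measurableSet_preimage (by fun_prop) hA)]
  simp only [zero_add]
  rfl

lemma sampledLaw_tuple (h : IsBrownianMotion x X) {s : ℝ} (hs : 0 < s) {k : ℕ}
    {t : Fin (k + 1) → PosRat} (ht : StrictMono t) {A : Set (Fin (k + 1) → Euc d)}
    (hA : MeasurableSet A) :
    sampledLaw X s ((fun f j => f (t j)) ⁻¹' A) =
      ∫⁻ z₀, ENNReal.ofReal (heatKernel d s (z₀ - x)) *
        ∫⁻ z in A, ENNReal.ofReal (jointDensity d z₀ (fun j => ((t j : ℚ) : ℝ)) z) := by
  let τ : Fin (k + 1) → ℝ := fun j => ((t j : ℚ) : ℝ)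
  have hpos : ∀ j, 0 < τ j := fun j => Rat.cast_pos.2 (t j).2
  let σ : Fin (k + 2) → ℝ := Fin.cons s fun j => s + τ j
  have hσmono : StrictMono σ := by
    refine strictMono_vecCons.2 ⟨?_, fun i j hij => ?_⟩
    · exact lt_add_of_pos_right s (hpos 0)
    · exact add_lt_add_right (Rat.cast_lt.2 (ht hij)) s
  have hσpos : ∀ j, 0 < σ j := by
    refine Fin.cases hs fun j => ?_
    exact add_pos hs (hpos j)
  let A' : Set (Fin (k + 2) → Euc d) := {z | Fin.tail z ∈ A}
  have htail : Measurable fun z : Fin (k + 2) → Euc d => Fin.tail z :=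
    measurable_pi_iff.2 fun j => measurable_pi_apply _
  have hA' : MeasurableSet A' := htail hA
  have hlaw : sampledLaw X s ((fun f j => f (t j)) ⁻¹' A) =
      ∫⁻ z in A', ENNReal.ofReal (jointDensity d x σ z) := by
    rw [← withDensity_apply _ hA', ← h.2.2 (k + 1) σ hσmono hσpos,
      Measure.map_apply_of_aemeasurable (h.aemeasurable_tuple hσmono hσpos) hA', sampledLaw,
      Measure.map_apply_of_aemeasurable (h.aemeasurable_sample hs.le)
        (measurableSet_preimage (by fun_prop) hA)]
    rfl
  have hjm : Measurable fun p : Euc d × (Fin (k + 1) → Euc d) =>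
      ENNReal.ofReal (jointDensity d p.1 τ p.2) :=
    (measurable_jointDensity d τ).ennreal_ofReal
  have hσm : Measurable fun z => ENNReal.ofReal (jointDensity d x σ z) :=
    ((measurable_jointDensity d σ).comp measurable_prodMk_left).ennreal_ofReal
  let e := MeasurableEquiv.piFinSuccAbove (fun _ : Fin (k + 2) => Euc d) 0
  have he : ∀ z₀ z, e.symm (z₀, z) = (Fin.cons z₀ z : Fin (k + 2) → Euc d) := fun z₀ z =>
    Fin.insertNth_zero' z₀ z
  have hmp : MeasurePreserving e.symm :=
    (volume_preserving_piFinSuccAbove (fun _ : Fin (k + 2) => Euc d) 0).symm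
  rw [hlaw, ← lintegral_indicator hA', ← hmp.lintegral_comp (hσm.indicator hA'),
    Measure.volume_eq_prod,
    lintegral_prod (fun p => A'.indicator _ (e.symm p))
      ((hσm.indicator hA').comp e.symm.measurable).aemeasurable]
  refine lintegral_congr fun z₀ => ?_
  rw [← lintegral_indicator hA, ← lintegral_const_mul _ (by
    exact (hjm.comp measurable_prodMk_left).indicator hA)]
  refine lintegral_congr fun z => ?_
  rw [he]
  by_cases hz : z ∈ A
  · have hz' : (Fin.cons z₀ z : Fin (k + 2) → Euc d) ∈ A' := hz
    rw [Set.indicator_of_mem hz', Set.indicator_of_mem hz, jointDensity_cons,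
      ENNReal.ofReal_mul (heatKernel_pos d hs _).le]
  · have hz' : (Fin.cons z₀ z : Fin (k + 2) → Euc d) ∉ A' := hz
    rw [Set.indicator_of_notMem hz', Set.indicator_of_notMem hz, mul_zero]

lemma lintegral_expFunctional (h : IsBrownianMotion x X) {v : Euc d → ℝ}
    (hv : Measurable v) (α : ℝ) {s : ℝ} (hs : 0 ≤ s) :
    ∫⁻ f, expFunctional v α f ∂sampledLaw X s =
      ∫⁻ ω, ENNReal.ofReal (Real.exp (α * ∫ t in Set.Ioi (0 : ℝ), v (X (s + t) ω))) := by
  rw [sampledLaw, lintegral_map' (measurable_expFunctional hv α).aemeasurable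
    (h.aemeasurable_sample hs)]
  refine lintegral_congr fun ω => ?_
  exact expFunctional_eq v α (w := fun t => X (s + t) ω)
    ((h.2.1 ω).comp (continuous_const.add continuous_id))

end IsBrownianMotion

/-- `x ↦ E[exp (α ∫₀^∞ v(W_x))]` as an extended nonnegative function. -/
def expMoment {Ω : Type*} [MeasureSpace Ω] {d : ℕ} (W : Euc d → ℝ → Ω → Euc d)
    (v : Euc d → ℝ) (α : ℝ) (x : Euc d) : ENNReal :=
  ∫⁻ f, expFunctional v α f ∂sampledLaw (W x) 0

/-- The heat semigroup applied to `expMoment`. -/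
def heatExpMoment {Ω : Type*} [MeasureSpace Ω] {d : ℕ} (W : Euc d → ℝ → Ω → Euc d)
    (v : Euc d → ℝ) (α s : ℝ) (x : Euc d) : ENNReal :=
  ∫⁻ z, ENNReal.ofReal (heatKernel d s (z - x)) * expMoment W v α z

lemma expMoment_eq {Ω : Type*} [MeasureSpace Ω] {d : ℕ} {W : Euc d → ℝ → Ω → Euc d}
    (hW : ∀ x, IsBrownianMotion x (W x)) {v : Euc d → ℝ}
    (hv : Measurable v) (α : ℝ) (x : Euc d) :
    expMoment W v α x = ∫⁻ ω, ENNReal.ofReal (Real.exp (α * pathIntInf v (W x) ω)) := by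
  rw [expMoment, (hW x).lintegral_expFunctional hv α le_rfl]
  simp [pathIntInf]

section Markov

variable {Ω : Type*} [MeasureSpace Ω] [IsProbabilityMeasure (ℙ : Measure Ω)] {d : ℕ}
  {W : Euc d → ℝ → Ω → Euc d}

lemma measurable_sampledLaw (hW : ∀ x, IsBrownianMotion x (W x)) :
    Measurable fun x => sampledLaw (W x) 0 := by
  have := fun x => (hW x).isProbabilityMeasure_sampledLaw le_rfl
  refine Measurable.measure_of_isPiSystem_of_isProbabilityMeasure
    (generateFrom_measurableCylinders (α := fun _ : PosRat => Euc d)).symm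
    isPiSystem_measurableCylinders fun S hS => ?_
  obtain ⟨k, t, A, ht, hA, rfl⟩ := exists_tuple_of_mem_measurableCylinders hS
  simp_rw [fun x => (hW x).sampledLaw_zero_tuple ht hA]
  exact (measurable_jointDensity d _).ennreal_ofReal.lintegral_prod_right'

/-- The Markov property at a fixed time. -/
lemma sampledLaw_eq_bind (hW : ∀ x, IsBrownianMotion x (W x)) (y : Euc d) {s : ℝ} (hs : 0 < s) :
    sampledLaw (W y) s =
      (volume.withDensity fun z => ENNReal.ofReal (heatKernel d s (z - y))).bind
        fun z => sampledLaw (W z) 0 := by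
  have hm := measurable_sampledLaw hW
  have hk : Measurable fun z => ENNReal.ofReal (heatKernel d s (z - y)) := by fun_prop
  have := (hW y).isProbabilityMeasure_sampledLaw hs.le
  have key : ∀ S ∈ measurableCylinders fun _ : PosRat => Euc d, sampledLaw (W y) s S =
      (volume.withDensity fun z => ENNReal.ofReal (heatKernel d s (z - y))).bind
        (fun z => sampledLaw (W z) 0) S := by
    intro S hS
    have hSm := MeasurableSet.of_mem_measurableCylinders hS
    obtain ⟨k, t, A, ht, hA, rfl⟩ := exists_tuple_of_mem_measurableCylinders hS
    rw [Measure.bind_apply hSm hm.aemeasurable,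
      lintegral_withDensity_eq_lintegral_mul _ hk (Measure.measurable_measure.1 hm _ hSm),
      (hW y).sampledLaw_tuple hs ht hA]
    refine lintegral_congr fun z => ?_
    rw [Pi.mul_apply, (hW z).sampledLaw_zero_tuple ht hA]
  exact ext_of_generate_finite _ generateFrom_measurableCylinders.symm
    isPiSystem_measurableCylinders key (key _ (univ_mem_measurableCylinders _))

lemma measurable_expMoment (hW : ∀ x, IsBrownianMotion x (W x)) {v : Euc d → ℝ}
    (hv : Measurable v) (α : ℝ) : Measurable (expMoment W v α) :=
  (Measure.measurable_lintegral (measurable_expFunctional hv α)).comp (measurable_sampledLaw hW)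

lemma heatExpMoment_eq (hW : ∀ x, IsBrownianMotion x (W x)) {v : Euc d → ℝ}
    (hv : Measurable v) (α : ℝ) {s : ℝ} (hs : 0 < s) (y : Euc d) :
    heatExpMoment W v α s y =
      ∫⁻ ω, ENNReal.ofReal (Real.exp (α * ∫ t in Set.Ioi (0 : ℝ), v (W y (s + t) ω))) := by
  have hk : Measurable fun z => ENNReal.ofReal (heatKernel d s (z - y)) := by fun_prop
  rw [← (hW y).lintegral_expFunctional hv α hs.le, sampledLaw_eq_bind hW y hs,
    Measure.lintegral_bind (measurable_sampledLaw hW).aemeasurable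
      (measurable_expFunctional hv α).aemeasurable]
  exact (lintegral_withDensity_eq_lintegral_mul _ hk (measurable_expMoment hW hv α)).symm

end Markov

/-- Shifting time by `s` changes `∫₀^∞` of a bounded function by at most `C s`, also when the
integral does not converge. -/
lemma abs_integral_Ioi_shift_sub_le {g : ℝ → ℝ} (hg : Measurable g) {C : ℝ}
    (hC : ∀ t, |g t| ≤ C) {s : ℝ} (hs : 0 ≤ s) :
    |(∫ t in Set.Ioi (0 : ℝ), g (s + t)) - ∫ t in Set.Ioi (0 : ℝ), g t| ≤ C * s := by
  have hshift : ∫ t in Set.Ioi (0 : ℝ), g (s + t) = ∫ t in Set.Ioi s, g t := by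
    have hpre : (fun t => s + t) ⁻¹' Set.Ioi s = Set.Ioi (0 : ℝ) := by simp
    rw [← hpre]
    exact (measurePreserving_add_left volume s).setIntegral_preimage_emb
      (measurableEmbedding_addLeft s) g (Set.Ioi s)
  have hIoc : IntegrableOn g (Set.Ioc 0 s) :=
    Measure.integrableOn_of_bounded (by simp) hg.aestronglyMeasurable
      (ae_of_all _ hC)
  have hC0 : 0 ≤ C := (abs_nonneg _).trans (hC 0)
  have hun : Set.Ioc 0 s ∪ Set.Ioi s = Set.Ioi 0 := Set.Ioc_union_Ioi_eq_Ioi hs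
  rw [hshift]
  by_cases hint : IntegrableOn g (Set.Ioi s)
  · rw [← hun, setIntegral_union (Set.Ioc_disjoint_Ioi le_rfl) measurableSet_Ioi hIoc hint,
      sub_add_cancel_right, abs_neg]
    have := norm_setIntegral_le_of_norm_le_const (μ := volume) (s := Set.Ioc 0 s) (f := g)
      (by simp) fun t _ => hC t
    simpa [measureReal_def, hs] using this
  · have hint' : ¬ IntegrableOn g (Set.Ioi 0) := fun h =>
      hint (h.mono_set (Set.Ioi_subset_Ioi hs))
    rw [integral_undef hint, integral_undef hint', sub_self, abs_zero]
    positivity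

section Continuity

variable {Ω : Type*} [MeasureSpace Ω] [IsProbabilityMeasure (ℙ : Measure Ω)] {d : ℕ}
  {W : Euc d → ℝ → Ω → Euc d}

lemma heatExpMoment_bounds (hW : ∀ x, IsBrownianMotion x (W x)) {v : Euc d → ℝ}
    (hv : Measurable v) {C : ℝ} (hC : ∀ z, |v z| ≤ C) (α : ℝ) {s : ℝ} (hs : 0 < s) (y : Euc d) :
    heatExpMoment W v α s y ≤ ENNReal.ofReal (Real.exp (|α| * C * s)) * expMoment W v α y ∧
      expMoment W v α y ≤ ENNReal.ofReal (Real.exp (|α| * C * s)) * heatExpMoment W v α s y := by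
  have hdiff : ∀ ω, |α * (∫ t in Set.Ioi (0 : ℝ), v (W y (s + t) ω)) -
      α * pathIntInf v (W y) ω| ≤ |α| * C * s := by
    intro ω
    rw [← mul_sub, abs_mul, mul_assoc]
    exact mul_le_mul_of_nonneg_left (abs_integral_Ioi_shift_sub_le
      (g := fun t => v (W y t ω)) (hv.comp ((hW y).2.1 ω).measurable) (fun _ => hC _) hs.le)
      (abs_nonneg α)
  rw [heatExpMoment_eq hW hv α hs y, expMoment_eq hW hv α y,
    ← lintegral_const_mul' _ _ ENNReal.ofReal_ne_top,
    ← lintegral_const_mul' _ _ ENNReal.ofReal_ne_top]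
  constructor <;> refine lintegral_mono fun ω => ?_ <;>
    rw [← ENNReal.ofReal_mul (Real.exp_pos _).le, ← Real.exp_add] <;>
    refine ENNReal.ofReal_le_ofReal (Real.exp_le_exp.2 ?_) <;>
    linarith [(abs_le.1 (hdiff ω)).1, (abs_le.1 (hdiff ω)).2]

lemma continuous_heatExpMoment (hW : ∀ x, IsBrownianMotion x (W x)) {v : Euc d → ℝ}
    (hv : Measurable v) {α : ℝ} (hfin : ∀ x, expMoment W v α x ≠ ⊤)
    (hheat : ∀ s, 0 < s → ∀ x, heatExpMoment W v α s x ≠ ⊤) {s : ℝ} (hs : 0 < s) :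
    Continuous (heatExpMoment W v α s) := by
  refine continuous_iff_continuousAt.2 fun x => ?_
  have hm := measurable_expMoment hW hv α
  set K : ℝ := (2 * π * s) ^ (-(d : ℝ) / 2) / (2 * π * (2 * s)) ^ (-(d : ℝ) / 2) *
    Real.exp (1 / (2 * s))
  have hK : 0 ≤ K := by positivity
  refine tendsto_lintegral_filter_of_dominated_convergence
    (fun z => ENNReal.ofReal K *
      (ENNReal.ofReal (heatKernel d (2 * s) (z - x)) * expMoment W v α z))
    (Eventually.of_forall fun y => by fun_prop) ?_ ?_ ?_
  · filter_upwards [Metric.closedBall_mem_nhds x one_pos] with y hy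
    rw [mem_closedBall_iff_norm] at hy
    refine ae_of_all _ fun z => ?_
    rw [← mul_assoc, ← ENNReal.ofReal_mul hK]
    gcongr
    exact heatKernel_sub_le d hs hy z
  · rw [lintegral_const_mul' _ _ ENNReal.ofReal_ne_top]
    exact ENNReal.mul_ne_top ENNReal.ofReal_ne_top (hheat (2 * s) (by positivity) x)
  · refine ae_of_all _ fun z => ENNReal.Tendsto.mul_const ?_ (Or.inr (hfin z))
    refine ENNReal.tendsto_ofReal (Continuous.tendsto ?_ x)
    fun_prop

end Continuity

/-- A function squeezed between `exp (∓ c s) g s`, for continuous functions `g s` with `s > 0`, is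
continuous. -/
lemma continuous_of_exp_squeeze {X : Type*} [TopologicalSpace X] {u : X → ℝ} {g : ℝ → X → ℝ}
    {c : ℝ} (hc : 0 ≤ c) (hu : ∀ x, 0 ≤ u x)
    (hg : ∀ s, 0 < s → Continuous (g s))
    (hgu : ∀ s, 0 < s → ∀ x, g s x ≤ Real.exp (c * s) * u x)
    (hug : ∀ s, 0 < s → ∀ x, u x ≤ Real.exp (c * s) * g s x) : Continuous u := by
  refine continuous_iff_continuousAt.2 fun x => ?_
  refine continuousAt_of_locally_uniform_approx_of_continuousAt fun V hV => ?_
  obtain ⟨ε, hε, hεV⟩ := Metric.mem_uniformity_dist.1 hV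
  set M : ℝ := Real.exp c * u x + 1
  have hlim : Tendsto (fun s => (Real.exp (c * s) - 1) * M) (𝓝[>] 0) (𝓝 0) := by
    have : Continuous fun s => (Real.exp (c * s) - 1) * M := by fun_prop
    simpa using (this.tendsto 0).mono_left nhdsWithin_le_nhds
  obtain ⟨s, hsε, hs, hs1⟩ := ((hlim.eventually (gt_mem_nhds hε)).and
    (Ioc_mem_nhdsGT one_pos)).exists
  have hcs : 0 ≤ c * s := by positivity
  have hexp : 1 ≤ Real.exp (c * s) := Real.one_le_exp hcs
  have hgx : g s x < M := by
    have : Real.exp (c * s) * u x ≤ Real.exp c * u x := by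
      gcongr
      · exact hu x
      · exact mul_le_of_le_one_right hc hs1
    have := hgu s hs x
    linarith
  refine ⟨_, (hg s hs).continuousAt.eventually (gt_mem_nhds hgx), g s, (hg s hs).continuousAt,
    fun y hy => hεV ?_⟩
  rw [Real.dist_eq]
  refine lt_of_le_of_lt ?_ hsε
  have hE : 0 ≤ Real.exp (c * s) - 1 := sub_nonneg.2 hexp
  have hgy : g s y < M := hy
  have hM : 0 ≤ M := add_nonneg (mul_nonneg (Real.exp_pos c).le (hu x)) zero_le_one
  have hgM : (Real.exp (c * s) - 1) * g s y ≤ (Real.exp (c * s) - 1) * M :=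
    mul_le_mul_of_nonneg_left hgy.le hE
  refine abs_sub_le_iff.2 ⟨by linarith [hug s hs y], ?_⟩
  rcases le_total (u y) (g s y) with h | h
  · linarith [hgu s hs y, mul_le_mul_of_nonneg_left h hE]
  · linarith [mul_nonneg hE hM]

/-- Lemma 2 (continuity): if `E[e^{αY_x}]` is finite for all `x`, it is continuous in `x`. -/
theorem stmt4 (d : ℕ) (hd : 3 ≤ d) (v : Euc d → ℝ)
    (hvm : Measurable v) (hvb : ∃ C : ℝ, ∀ z, |v z| ≤ C)
    (hvs : ∃ R : ℝ, ∀ z, v z ≠ 0 → ‖z‖ ≤ R)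
    {Ω : Type*} [MeasureSpace Ω] [IsProbabilityMeasure (ℙ : Measure Ω)]
    (W : Euc d → ℝ → Ω → Euc d) (hW : ∀ x, IsBrownianMotion x (W x)) (α : ℝ)
    (hfin : ∀ x : Euc d, Integrable (fun ω => Real.exp (α * pathIntInf v (W x) ω)) ℙ) :
    Continuous fun x : Euc d => ∫ ω, Real.exp (α * pathIntInf v (W x) ω) := by
  obtain ⟨C, hC⟩ := hvb
  have hC0 : 0 ≤ C := (abs_nonneg _).trans (hC 0)
  have hexp : ∀ x, expMoment W v α x =
      ENNReal.ofReal (∫ ω, Real.exp (α * pathIntInf v (W x) ω)) := fun x => by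
    rw [expMoment_eq hW hvm α x, ofReal_integral_eq_lintegral_ofReal (hfin x)
      (ae_of_all _ fun ω => (Real.exp_pos _).le)]
  have hpos : ∀ x, 0 ≤ ∫ ω, Real.exp (α * pathIntInf v (W x) ω) := fun x =>
    integral_nonneg fun ω => (Real.exp_pos _).le
  have htop : ∀ x, expMoment W v α x ≠ ⊤ := fun x => by
    rw [hexp]
    exact ENNReal.ofReal_ne_top
  have hbounds := fun s (hs : 0 < s) => heatExpMoment_bounds hW hvm hC α hs
  have hheat : ∀ s, 0 < s → ∀ x, heatExpMoment W v α s x ≠ ⊤ := fun s hs x =>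
    ne_top_of_le_ne_top (ENNReal.mul_ne_top ENNReal.ofReal_ne_top (htop x)) (hbounds s hs x).1
  refine continuous_of_exp_squeeze (g := fun s x => (heatExpMoment W v α s x).toReal)
    (mul_nonneg (abs_nonneg α) hC0) hpos (fun s hs => ?_) (fun s hs x => ?_) fun s hs x => ?_
  · exact ENNReal.continuousOn_toReal.comp_continuous
      (continuous_heatExpMoment hW hvm htop hheat hs) (hheat s hs)
  · have h := (hbounds s hs x).1
    rw [hexp, ← ENNReal.ofReal_mul (Real.exp_pos _).le] at h
    exact ENNReal.toReal_le_of_le_ofReal (mul_nonneg (Real.exp_pos _).le (hpos x)) h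
  · have h := ENNReal.toReal_mono
      (ENNReal.mul_ne_top ENNReal.ofReal_ne_top (hheat s hs x)) (hbounds s hs x).2
    rwa [hexp, ENNReal.toReal_mul, ENNReal.toReal_ofReal (hpos x),
      ENNReal.toReal_ofReal (Real.exp_pos _).le] at h

end
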